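/- Let 𝒲 be a category with terminal object ⊤, L : 𝒲 ⥤ 𝒲 an endofunctor, U an object of 𝒲, and e : L.obj ⊤ ≅ U (so L is an endomultiplier for U); write π₂(W) = L.map(!_W) ≫ e.hom and let fresh : 𝒲 ⥤ Over U send W to the slice (L.obj W, π₂(W)). Suppose L is 3/4-cartesian, i.e. it carries a copoint π₁ : L ⟶ 𝟭_𝒲 and a natural transformation δ : L ⟶ L ⋙ L satisfying, for all W, δ_W ≫ π₁_{L.obj W} = 𝟙 and δ_W ≫ L.map(π₁_W) = 𝟙. If fresh is full (the multiplier is affine), then U is a terminal object of 𝒲. -/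

import Mathlib

open CategoryTheory CategoryTheory.Limits

universe v u

variable {𝒲 : Type u} [Category.{v} 𝒲] [HasTerminal 𝒲]

/-- The second projection of a multiplier `L` for `U` (with `e : L.obj ⊤ ≅ U`). -/
noncomputable def Multiplier.pi2 (L : 𝒲 ⥤ 𝒲) (U : 𝒲) (e : L.obj (⊤_ 𝒲) ≅ U) (W : 𝒲) :
    L.obj W ⟶ U :=
  L.map (terminal.from W) ≫ e.hom

/-- The fresh weakening functor of a multiplier. -/
noncomputable def Multiplier.fresh (L : 𝒲 ⥤ 𝒲) (U : 𝒲) (e : L.obj (⊤_ 𝒲) ≅ U) : 𝒲 ⥤ Over U where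
  obj W := Over.mk (Multiplier.pi2 L U e W)
  map {W W'} f := Over.homMk (L.map f) (by
    simp only [Multiplier.pi2, Over.mk_hom, ← Category.assoc, ← L.map_comp, terminal.comp_from])

/-- A 3/4-cartesian affine endomultiplier has terminal multiplicand. -/
theorem terminal_of_threeQuarterCartesian_affine
    (L : 𝒲 ⥤ 𝒲) (U : 𝒲) (e : L.obj (⊤_ 𝒲) ≅ U)
    (π₁ : L ⟶ 𝟭 𝒲) (δ : L ⟶ L ⋙ L)
    (hδπ : ∀ W : 𝒲, δ.app W ≫ π₁.app (L.obj W) = 𝟙 (L.obj W))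
    (hδLπ : ∀ W : 𝒲, δ.app W ≫ L.map (π₁.app W) = 𝟙 (L.obj W))
    (hfull : (Multiplier.fresh L U e).Full) :
    Nonempty (IsTerminal U) := by
  let T := ⊤_ 𝒲
  have h1 : δ.app T ≫ L.map (terminal.from (L.obj T)) = 𝟙 (L.obj T) := by
    rw [← hδLπ T]
    congr 2
    exact Subsingleton.elim _ _
  have h2 : L.map (terminal.from T) = 𝟙 (L.obj T) := by
    rw [← L.map_id]
    congr 1
    exact Subsingleton.elim _ _
  let g : (Multiplier.fresh L U e).obj T ⟶ (Multiplier.fresh L U e).obj (L.obj T) :=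
    Over.homMk (δ.app T) (by
      change δ.app T ≫ L.map (terminal.from (L.obj T)) ≫ e.hom = L.map (terminal.from T) ≫ e.hom
      rw [← Category.assoc, h1, h2])
  obtain ⟨f, hf⟩ := hfull.map_surjective g
  have hf' : L.map f = δ.app T := congrArg (fun k => k.left) hf
  have h3 : π₁.app T ≫ f = 𝟙 (L.obj T) := by
    have := π₁.naturality f
    rw [hf', hδπ T] at this
    exact this.symm
  have h4 : f ≫ π₁.app T = 𝟙 T := terminal.hom_ext _ _
  let i : T ≅ L.obj T := ⟨f, π₁.app T, h4, h3⟩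
  exact ⟨terminalIsTerminal.ofIso (i ≪≫ e)⟩
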